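/- Let ρ_AB be a two-qubit density matrix (on ℂ² ⊗ ℂ²) and let ψ = (|00⟩ + |11⟩)/√2 be the maximally entangled Bell state. If ⟨ψ| ρ_AB |ψ⟩ ≥ 1 − ε for some ε ≥ 0, then μ(ρ_AB) ≥ 1 − 2ε. -/

import Mathlib

open scoped Matrix Kronecker ComplexOrder
open Matrix

noncomputable section

/-- Partial trace over the second (B) system. -/
def ptrB {A B : Type*} [Fintype B] (ρ : Matrix (A × B) (A × B) ℂ) : Matrix A A ℂ :=
  fun i j => ∑ k, ρ (i, k) (j, k)

/-- Partial trace over the first (A) system. -/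
def ptrA {A B : Type*} [Fintype A] (ρ : Matrix (A × B) (A × B) ℂ) : Matrix B B ℂ :=
  fun k l => ∑ i, ρ (i, k) (i, l)

/-- A density matrix: positive semidefinite with trace one. -/
def IsDensity {n : Type*} [Fintype n] (ρ : Matrix n n ℂ) : Prop :=
  ρ.PosSemidef ∧ ρ.trace = 1

/-- Maximal correlation of a bipartite state. -/
def mu {A B : Type*} [Fintype A] [Fintype B] (ρ : Matrix (A × B) (A × B) ℂ) : ℝ :=
  sSup {r : ℝ | ∃ (X : Matrix A A ℂ) (Y : Matrix B B ℂ),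
    ((ptrB ρ) * X).trace = 0 ∧ ((ptrA ρ) * Y).trace = 0 ∧
    ((ptrB ρ) * (X * Xᴴ)).trace = 1 ∧ ((ptrA ρ) * (Y * Yᴴ)).trace = 1 ∧
    r = ‖(ρ * (X ⊗ₖ Yᴴ)).trace‖}

/-- Maximal entanglement: infimum over finite decompositions of the max correlation. -/
def muEnt {A B : Type*} [Fintype A] [Fintype B] (ρ : Matrix (A × B) (A × B) ℂ) : ℝ :=
  sInf {r : ℝ | ∃ (m : ℕ) (p : Fin m → ℝ) (τ : Fin m → Matrix (A × B) (A × B) ℂ),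
    (∀ i, 0 ≤ p i) ∧ (∑ i, p i) = 1 ∧ (∀ i, IsDensity (τ i)) ∧
    ρ = ∑ i, p i • τ i ∧ r = ⨆ i, mu (τ i)}

/-- Application of a product channel given by local Kraus operators. -/
def applyLocal {A B A' B' ι κ : Type*} [Fintype A] [Fintype B] [Fintype ι] [Fintype κ]
    (K : ι → Matrix A' A ℂ) (L : κ → Matrix B' B ℂ)
    (ρ : Matrix (A × B) (A × B) ℂ) : Matrix (A' × B') (A' × B') ℂ :=
  ∑ k, ∑ m, (K k ⊗ₖ L m) * ρ * (K k ⊗ₖ L m)ᴴ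

/-- Tensor product of two bipartite states, with the A-systems grouped together. -/
def prodState {A B A' B' : Type*}
    (ρ : Matrix (A × B) (A × B) ℂ) (σ : Matrix (A' × B') (A' × B') ℂ) :
    Matrix ((A × A') × (B × B')) ((A × A') × (B × B')) ℂ :=
  fun x y => ρ (x.1.1, x.2.1) (y.1.1, y.2.1) * σ (x.1.2, x.2.2) (y.1.2, y.2.2)

/-- n-fold tensor power of a bipartite state, with all A-systems grouped together. -/
def powState {A B : Type*} (ρ : Matrix (A × B) (A × B) ℂ) (n : ℕ) :
    Matrix ((Fin n → A) × (Fin n → B)) ((Fin n → A) × (Fin n → B)) ℂ :=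
  fun x y => ∏ i, ρ (x.1 i, x.2 i) (y.1 i, y.2 i)

/-- The two-qubit Bell vector (|00⟩+|11⟩)/√2. -/
def bellVec : Fin 2 × Fin 2 → ℂ := fun p => if p.1 = p.2 then 1 / (Real.sqrt 2 : ℂ) else 0

/-- Inverse of the positive semidefinite square root. -/
def invSqrt {n : Type*} [Fintype n] [DecidableEq n] (M : Matrix n n ℂ) : Matrix n n ℂ :=
  letI := Classical.dec M.PosSemidef
  if h : M.PosSemidef then
    ((h.1.eigenvectorUnitary : Matrix n n ℂ) *
      diagonal ((↑) ∘ Real.sqrt ∘ h.1.eigenvalues : n → ℂ) *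
      (star h.1.eigenvectorUnitary : Matrix n n ℂ))⁻¹ else 0


section MaximalCorrelation

variable {A B n : Type*} [Fintype A] [Fintype B] [Fintype n]

theorem Matrix.PosSemidef.trace_mul_mul_conjTranspose_nonneg {σ : Matrix n n ℂ}
    (hσ : σ.PosSemidef) (Z : Matrix n n ℂ) : 0 ≤ (σ * (Z * Zᴴ)).trace := by
  have h := (hσ.conjTranspose_mul_mul_same Z).trace_nonneg
  rwa [Matrix.mul_assoc, Matrix.trace_mul_comm, Matrix.mul_assoc] at h

/-- Cauchy–Schwarz inequality for the sesquilinear form `(P, Q) ↦ tr (ρ P Qᴴ)`. -/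
theorem norm_trace_mul_mul_conjTranspose_sq_le {ρ : Matrix n n ℂ} (hρ : ρ.PosSemidef)
    (P Q : Matrix n n ℂ) :
    ‖(ρ * (P * Qᴴ)).trace‖ ^ 2 ≤ (ρ * (P * Pᴴ)).trace.re * (ρ * (Q * Qᴴ)).trace.re := by
  have nonneg (Z : Matrix n n ℂ) : 0 ≤ (ρ * (Z * Zᴴ)).trace.re :=
    (Complex.le_def.mp (hρ.trace_mul_mul_conjTranspose_nonneg Z)).1
  have hconj : (ρ * (Q * Pᴴ)).trace = star (ρ * (P * Qᴴ)).trace := by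
    rw [← Matrix.trace_conjTranspose, Matrix.conjTranspose_mul, Matrix.conjTranspose_mul,
      Matrix.conjTranspose_conjTranspose, hρ.isHermitian.eq, Matrix.trace_mul_comm]
  set b := (ρ * (P * Qᴴ)).trace with hb
  have hquad (t : ℝ) : 0 ≤ (ρ * (P * Pᴴ)).trace.re * (t * t) + (-2 * ‖b‖ ^ 2) * t
      + ‖b‖ ^ 2 * (ρ * (Q * Qᴴ)).trace.re := by
    have h := nonneg ((t : ℂ) • P - b • Q)
    have e : (ρ * (((t : ℂ) • P - b • Q) * ((t : ℂ) • P - b • Q)ᴴ)).trace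
        = (t : ℂ) * t * (ρ * (P * Pᴴ)).trace - 2 * t * (b * star b)
          + b * star b * (ρ * (Q * Qᴴ)).trace := by
      simp only [Matrix.conjTranspose_sub, Matrix.conjTranspose_smul, Matrix.sub_mul,
        Matrix.mul_sub, Matrix.smul_mul, Matrix.mul_smul, Matrix.trace_sub, Matrix.trace_smul,
        smul_eq_mul, hconj, ← hb, RCLike.star_def, Complex.conj_ofReal]
      ring
    have hbb : b * star b = ((‖b‖ ^ 2 : ℝ) : ℂ) := by
      rw [RCLike.star_def, Complex.mul_conj, Complex.normSq_eq_norm_sq]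
    rw [e, hbb] at h
    have e2 : ((t : ℂ) * t * (ρ * (P * Pᴴ)).trace - 2 * t * ((‖b‖ ^ 2 : ℝ) : ℂ)
          + ((‖b‖ ^ 2 : ℝ) : ℂ) * (ρ * (Q * Qᴴ)).trace)
        = ((t * t : ℝ) : ℂ) * (ρ * (P * Pᴴ)).trace - ((2 * t * ‖b‖ ^ 2 : ℝ) : ℂ)
          + ((‖b‖ ^ 2 : ℝ) : ℂ) * (ρ * (Q * Qᴴ)).trace := by push_cast; ring
    rw [e2, Complex.add_re, Complex.sub_re, Complex.re_ofReal_mul, Complex.re_ofReal_mul,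
      Complex.ofReal_re] at h
    linarith
  have hd := discrim_le_zero hquad
  rw [discrim] at hd
  rcases eq_or_ne b 0 with h0 | h0
  · rw [h0]
    simpa using mul_nonneg (nonneg P) (nonneg Q)
  · have hpos : 0 < ‖b‖ ^ 2 := by positivity
    refine le_of_mul_le_mul_left ?_ hpos
    linarith

theorem trace_ptrB_mul [DecidableEq B] (ρ : Matrix (A × B) (A × B) ℂ) (X : Matrix A A ℂ) :
    (ptrB ρ * X).trace = (ρ * (X ⊗ₖ (1 : Matrix B B ℂ))).trace := by
  simp only [Matrix.trace, Matrix.diag, Matrix.mul_apply, ptrB, Fintype.sum_prod_type,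
    Matrix.kroneckerMap_apply, Matrix.one_apply, mul_ite, mul_one, mul_zero,
    Finset.sum_ite_eq', Finset.mem_univ, if_true, Finset.sum_mul]
  exact Finset.sum_congr rfl fun _ _ => Finset.sum_comm

theorem trace_ptrA_mul [DecidableEq A] (ρ : Matrix (A × B) (A × B) ℂ) (Y : Matrix B B ℂ) :
    (ptrA ρ * Y).trace = (ρ * ((1 : Matrix A A ℂ) ⊗ₖ Y)).trace := by
  simp only [Matrix.trace, Matrix.diag, Matrix.mul_apply, ptrA, Fintype.sum_prod_type,
    Matrix.kroneckerMap_apply, Matrix.one_apply, ite_mul, one_mul, zero_mul, mul_ite, mul_zero,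
    Finset.sum_ite_irrel, Finset.sum_const_zero,
    Finset.sum_ite_eq', Finset.mem_univ, if_true, Finset.sum_mul]
  rw [Finset.sum_comm (γ := A)]
  exact Finset.sum_congr rfl fun _ _ => Finset.sum_comm

theorem trace_ptrB (ρ : Matrix (A × B) (A × B) ℂ) : (ptrB ρ).trace = ρ.trace := by
  simp [Matrix.trace, ptrB, Fintype.sum_prod_type]

theorem trace_ptrA (ρ : Matrix (A × B) (A × B) ℂ) : (ptrA ρ).trace = ρ.trace := by
  simp only [Matrix.trace, Matrix.diag, ptrA, Fintype.sum_prod_type]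
  exact Finset.sum_comm

omit [Fintype A] in
theorem posSemidef_ptrB {ρ : Matrix (A × B) (A × B) ℂ} (hρ : ρ.PosSemidef) :
    (ptrB ρ).PosSemidef := by
  have e : ptrB ρ = ∑ k, ρ.submatrix (fun i => (i, k)) (fun i => (i, k)) := by
    ext i j
    simp [ptrB, Matrix.sum_apply]
  rw [e]
  exact Matrix.posSemidef_sum _ fun k _ => hρ.submatrix _

omit [Fintype B] in
theorem posSemidef_ptrA {ρ : Matrix (A × B) (A × B) ℂ} (hρ : ρ.PosSemidef) :
    (ptrA ρ).PosSemidef := by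
  have e : ptrA ρ = ∑ i, ρ.submatrix (fun k => (i, k)) (fun k => (i, k)) := by
    ext k l
    simp [ptrA, Matrix.sum_apply]
  rw [e]
  exact Matrix.posSemidef_sum _ fun i _ => hρ.submatrix _

theorem norm_trace_mul_kronecker_sq_le {ρ : Matrix (A × B) (A × B) ℂ} (hρ : ρ.PosSemidef)
    (X : Matrix A A ℂ) (Y : Matrix B B ℂ) :
    ‖(ρ * (X ⊗ₖ Yᴴ)).trace‖ ^ 2
      ≤ (ptrB ρ * (X * Xᴴ)).trace.re * (ptrA ρ * (Y * Yᴴ)).trace.re := by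
  classical
  have h := norm_trace_mul_mul_conjTranspose_sq_le hρ (X ⊗ₖ (1 : Matrix B B ℂ))
    ((1 : Matrix A A ℂ) ⊗ₖ Y)
  simpa only [Matrix.conjTranspose_kronecker, ← Matrix.mul_kronecker_mul,
    Matrix.conjTranspose_one, Matrix.mul_one, Matrix.one_mul, ← trace_ptrB_mul,
    ← trace_ptrA_mul] using h

/-- The correlations of normalized centered pairs are at most one. -/
theorem correlation_le_one {ρ : Matrix (A × B) (A × B) ℂ} (hρ : ρ.PosSemidef)
    {r : ℝ} (hr : ∃ (X : Matrix A A ℂ) (Y : Matrix B B ℂ),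
      ((ptrB ρ) * X).trace = 0 ∧ ((ptrA ρ) * Y).trace = 0 ∧
      ((ptrB ρ) * (X * Xᴴ)).trace = 1 ∧ ((ptrA ρ) * (Y * Yᴴ)).trace = 1 ∧
      r = ‖(ρ * (X ⊗ₖ Yᴴ)).trace‖) : r ≤ 1 := by
  obtain ⟨X, Y, -, -, hX, hY, rfl⟩ := hr
  have h := norm_trace_mul_kronecker_sq_le hρ X Y
  rw [hX, hY, Complex.one_re, one_mul] at h
  exact (sq_le_one_iff₀ (norm_nonneg _)).mp h

theorem mu_nonneg (ρ : Matrix (A × B) (A × B) ℂ) : 0 ≤ mu ρ := by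
  apply Real.sSup_nonneg
  rintro r ⟨X, Y, -, -, -, -, rfl⟩
  exact norm_nonneg _

theorem mu_le_one {ρ : Matrix (A × B) (A × B) ℂ} (hρ : ρ.PosSemidef) : mu ρ ≤ 1 :=
  Real.sSup_le (fun _ hr => correlation_le_one hρ hr) zero_le_one

theorem norm_trace_mul_kronecker_le_mu {ρ : Matrix (A × B) (A × B) ℂ} (hρ : ρ.PosSemidef)
    {X : Matrix A A ℂ} {Y : Matrix B B ℂ}
    (hX : (ptrB ρ * X).trace = 0) (hY : (ptrA ρ * Y).trace = 0) :
    ‖(ρ * (X ⊗ₖ Yᴴ)).trace‖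
      ≤ mu ρ * (((ptrB ρ * (X * Xᴴ)).trace.re + (ptrA ρ * (Y * Yᴴ)).trace.re) / 2) := by
  have hcs := norm_trace_mul_kronecker_sq_le hρ X Y
  have hx := (posSemidef_ptrB hρ).trace_mul_mul_conjTranspose_nonneg X
  have hy := (posSemidef_ptrA hρ).trace_mul_mul_conjTranspose_nonneg Y
  obtain ⟨v, hv, hvX⟩ := RCLike.nonneg_iff_exists_ofReal.mp hx
  obtain ⟨w, hw, hwY⟩ := RCLike.nonneg_iff_exists_ofReal.mp hy
  change (v : ℂ) = _ at hvX
  change (w : ℂ) = _ at hwY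
  rw [← hvX, ← hwY, Complex.ofReal_re, Complex.ofReal_re] at hcs ⊢
  have hmu := mu_nonneg ρ
  rcases (mul_nonneg hv hw).eq_or_lt with h0 | h0
  · rw [← h0] at hcs
    have : ‖(ρ * (X ⊗ₖ Yᴴ)).trace‖ = 0 :=
      (pow_eq_zero_iff two_ne_zero).mp (le_antisymm hcs (sq_nonneg _))
    rw [this]
    positivity
  have hv' : 0 < v := lt_of_le_of_ne hv (by rintro rfl; simp at h0)
  have hw' : 0 < w := lt_of_le_of_ne hw (by rintro rfl; simp at h0)
  have inv_sq {x : ℝ} (hx : 0 < x) : (((√x)⁻¹ : ℝ) : ℂ) * ((((√x)⁻¹ : ℝ) : ℂ) * (x : ℂ)) = 1 := by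
    norm_cast
    have := Real.sq_sqrt hx.le
    have : √x ≠ 0 := (Real.sqrt_pos.mpr hx).ne'
    field_simp
    linarith
  have hle : (√v)⁻¹ * ((√w)⁻¹ * ‖(ρ * (X ⊗ₖ Yᴴ)).trace‖) ≤ mu ρ := by
    refine le_csSup ⟨1, fun _ hr => correlation_le_one hρ hr⟩
      ⟨(((√v)⁻¹ : ℝ) : ℂ) • X, (((√w)⁻¹ : ℝ) : ℂ) • Y, ?_, ?_, ?_, ?_, ?_⟩
    · rw [Matrix.mul_smul, Matrix.trace_smul, hX, smul_zero]
    · rw [Matrix.mul_smul, Matrix.trace_smul, hY, smul_zero]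
    · simp only [Matrix.conjTranspose_smul, Matrix.mul_smul, Matrix.smul_mul, Matrix.trace_smul,
        ← hvX, smul_eq_mul, RCLike.star_def, Complex.conj_ofReal]
      exact inv_sq hv'
    · simp only [Matrix.conjTranspose_smul, Matrix.mul_smul, Matrix.smul_mul, Matrix.trace_smul,
        ← hwY, smul_eq_mul, RCLike.star_def, Complex.conj_ofReal]
      exact inv_sq hw'
    · simp only [Matrix.conjTranspose_smul, Matrix.smul_kronecker, Matrix.kronecker_smul,
        Matrix.mul_smul, Matrix.trace_smul, smul_eq_mul, norm_mul, RCLike.star_def,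
        Complex.conj_ofReal, Complex.norm_real, Real.norm_eq_abs, abs_inv,
        abs_of_nonneg (Real.sqrt_nonneg _)]
      ring
  have hsv := Real.sqrt_pos.mpr hv'
  have hsw := Real.sqrt_pos.mpr hw'
  calc ‖(ρ * (X ⊗ₖ Yᴴ)).trace‖
      = (√v)⁻¹ * ((√w)⁻¹ * ‖(ρ * (X ⊗ₖ Yᴴ)).trace‖) * (√v * √w) := by field_simp
    _ ≤ mu ρ * (√v * √w) := by gcongr
    _ ≤ mu ρ * ((v + w) / 2) := by
      gcongr
      nlinarith [sq_nonneg (√v - √w), Real.sq_sqrt hv, Real.sq_sqrt hw]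

theorem trace_mul_sub_smul_one [DecidableEq n] {σ : Matrix n n ℂ} (ht : σ.trace = 1)
    (Z : Matrix n n ℂ) : (σ * (Z - (σ * Z).trace • 1)).trace = 0 := by
  simp [Matrix.mul_sub, Matrix.trace_sub, ht]

theorem Matrix.IsHermitian.trace_mul_conjTranspose {σ : Matrix n n ℂ} (hσ : σ.IsHermitian)
    (Z : Matrix n n ℂ) : (σ * Zᴴ).trace = star (σ * Z).trace := by
  rw [← Matrix.trace_conjTranspose, Matrix.conjTranspose_mul, hσ.eq, Matrix.trace_mul_comm]

theorem variance_sub_smul_one [DecidableEq n] {σ : Matrix n n ℂ}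
    (hσ : σ.IsHermitian) (ht : σ.trace = 1) (Z : Matrix n n ℂ) :
    (σ * ((Z - (σ * Z).trace • 1) * (Z - (σ * Z).trace • 1)ᴴ)).trace.re
      = (σ * (Z * Zᴴ)).trace.re - ‖(σ * Z).trace‖ ^ 2 := by
  have h := hσ.trace_mul_conjTranspose Z
  generalize hz : (σ * Z).trace = z at h ⊢
  have e : (σ * ((Z - z • 1) * (Z - z • 1)ᴴ)).trace = (σ * (Z * Zᴴ)).trace - z * star z := by
    simp only [Matrix.conjTranspose_sub, Matrix.conjTranspose_smul, Matrix.conjTranspose_one,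
      Matrix.sub_mul, Matrix.mul_sub, Matrix.smul_mul, Matrix.mul_smul, Matrix.trace_sub,
      Matrix.trace_smul, Matrix.one_mul, Matrix.mul_one, smul_eq_mul, h, hz, ht]
    ring
  rw [e, RCLike.star_def, Complex.mul_conj, Complex.normSq_eq_norm_sq, Complex.sub_re,
    Complex.ofReal_re]

/-- The maximal correlation bounds the covariance of arbitrary local operators. -/
theorem norm_covariance_le_mu {ρ : Matrix (A × B) (A × B) ℂ} (hρ : IsDensity ρ)
    (X : Matrix A A ℂ) (Y : Matrix B B ℂ) :
    ‖(ρ * (X ⊗ₖ Yᴴ)).trace - (ptrB ρ * X).trace * star (ptrA ρ * Y).trace‖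
      ≤ mu ρ * (((ptrB ρ * (X * Xᴴ)).trace.re - ‖(ptrB ρ * X).trace‖ ^ 2
        + ((ptrA ρ * (Y * Yᴴ)).trace.re - ‖(ptrA ρ * Y).trace‖ ^ 2)) / 2) := by
  classical
  have hB := (posSemidef_ptrB hρ.1).isHermitian
  have hA := (posSemidef_ptrA hρ.1).isHermitian
  have htB : (ptrB ρ).trace = 1 := (trace_ptrB ρ).trans hρ.2
  have htA : (ptrA ρ).trace = 1 := (trace_ptrA ρ).trans hρ.2
  have h := norm_trace_mul_kronecker_le_mu hρ.1 (trace_mul_sub_smul_one htB X)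
    (trace_mul_sub_smul_one htA Y)
  rw [variance_sub_smul_one hB htB, variance_sub_smul_one hA htA] at h
  convert h using 2
  have hY := hA.trace_mul_conjTranspose Y
  rw [trace_ptrA_mul] at hY
  have hX := trace_ptrB_mul ρ X
  generalize (ptrB ρ * X).trace = x at hX ⊢
  generalize (ptrA ρ * Y).trace = y at hY ⊢
  rw [Matrix.conjTranspose_sub, Matrix.conjTranspose_smul, Matrix.conjTranspose_one]
  simp only [sub_eq_add_neg, ← neg_smul, Matrix.add_kronecker, Matrix.kronecker_add,
    Matrix.smul_kronecker, Matrix.kronecker_smul, Matrix.one_kronecker_one, Matrix.mul_add,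
    Matrix.mul_smul, Matrix.mul_one, Matrix.trace_add, Matrix.trace_smul, smul_eq_mul,
    hY, ← hX, hρ.2]
  ring

/-- The purity of a qubit state is at most one. -/
theorem sum_norm_sq_le_one {σ : Matrix (Fin 2) (Fin 2) ℂ} (hσ : σ.PosSemidef)
    (ht : σ.trace = 1) : ∑ i, ∑ j, ‖σ i j‖ ^ 2 ≤ 1 := by
  have hd := (Complex.le_def.mp hσ.det_nonneg).1
  obtain ⟨a, ha, haσ⟩ := RCLike.nonneg_iff_exists_ofReal.mp (hσ.diag_nonneg (i := 0))
  obtain ⟨b, hb, hbσ⟩ := RCLike.nonneg_iff_exists_ofReal.mp (hσ.diag_nonneg (i := 1))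
  change (a : ℂ) = _ at haσ
  change (b : ℂ) = _ at hbσ
  have h10 : σ 1 0 = star (σ 0 1) := (hσ.isHermitian.apply 1 0).symm
  rw [Matrix.trace_fin_two, ← haσ, ← hbσ] at ht
  have hab : a + b = 1 := by exact_mod_cast ht
  rw [Matrix.det_fin_two, h10, ← haσ, ← hbσ, RCLike.star_def, Complex.mul_conj,
    Complex.normSq_eq_norm_sq, ← Complex.ofReal_mul, ← Complex.ofReal_sub, Complex.ofReal_re,
    Complex.zero_re] at hd
  simp only [Fin.sum_univ_two, h10, norm_star, ← haσ, ← hbσ, Complex.norm_real,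
    Real.norm_eq_abs, sq_abs]
  nlinarith

theorem norm_entry_covariance_le_mu {ρ : Matrix (Fin 2 × Fin 2) (Fin 2 × Fin 2) ℂ}
    (hρ : IsDensity ρ) (i j : Fin 2) :
    ‖ρ (j, j) (i, i) - ptrB ρ j i * star (ptrA ρ i j)‖
      ≤ mu ρ * (((ptrB ρ i i).re - ‖ptrB ρ j i‖ ^ 2
        + ((ptrA ρ j j).re - ‖ptrA ρ i j‖ ^ 2)) / 2) := by
  have h := norm_covariance_le_mu hρ (Matrix.single i j 1) (Matrix.single j i 1)
  simpa [Matrix.trace_mul_single, Matrix.single_kronecker_single] using h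

theorem bell_fidelity_eq (ρ : Matrix (Fin 2 × Fin 2) (Fin 2 × Fin 2) ℂ) :
    star bellVec ⬝ᵥ ρ.mulVec bellVec = (1 / 2 : ℝ) * ∑ i, ∑ j, ρ (j, j) (i, i) := by
  have h2 : (√2 : ℂ)⁻¹ * (√2 : ℂ)⁻¹ = (1 / 2 : ℝ) := by
    rw [← mul_inv, ← Complex.ofReal_mul, Real.mul_self_sqrt zero_le_two]
    norm_num
  rw [← h2]
  simp [dotProduct, Matrix.mulVec, bellVec, Fintype.sum_prod_type, Fin.sum_univ_two]
  ring

theorem re_mul_star_le (z w : ℂ) : (z * star w).re ≤ (‖z‖ ^ 2 + ‖w‖ ^ 2) / 2 := by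
  have h := (Complex.re_le_norm (z * star w))
  rw [norm_mul, norm_star] at h
  nlinarith [sq_nonneg (‖z‖ - ‖w‖)]

end MaximalCorrelation

/-- If a two-qubit state has fidelity at least `1 - ε` with the Bell state, then
`μ(ρ) ≥ 1 - 2ε`. -/
theorem mu_ge_of_bell_fidelity (ρ : Matrix (Fin 2 × Fin 2) (Fin 2 × Fin 2) ℂ)
    (hρ : IsDensity ρ) (ε : ℝ) (hε : 0 ≤ ε)
    (h : 1 - ε ≤ (star bellVec ⬝ᵥ ρ.mulVec bellVec).re) :
    1 - 2 * ε ≤ mu ρ := by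
  have hBp := posSemidef_ptrB hρ.1
  have hAp := posSemidef_ptrA hρ.1
  have htB : (ptrB ρ).trace = 1 := (trace_ptrB ρ).trans hρ.2
  have htA : (ptrA ρ).trace = 1 := (trace_ptrA ρ).trans hρ.2
  have hSB := sum_norm_sq_le_one hBp htB
  have hSA := sum_norm_sq_le_one hAp htA
  have key (i j : Fin 2) : (ρ (j, j) (i, i)).re
      ≤ (‖ptrB ρ j i‖ ^ 2 + ‖ptrA ρ i j‖ ^ 2) / 2
        + mu ρ * (((ptrB ρ i i).re - ‖ptrB ρ j i‖ ^ 2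
          + ((ptrA ρ j j).re - ‖ptrA ρ i j‖ ^ 2)) / 2) := by
    have h1 := (Complex.re_le_norm _).trans (norm_entry_covariance_le_mu hρ i j)
    rw [Complex.sub_re] at h1
    linarith [re_mul_star_le (ptrB ρ j i) (ptrA ρ i j)]
  rw [Matrix.trace_fin_two] at htB htA
  replace htB := congrArg Complex.re htB
  replace htA := congrArg Complex.re htA
  rw [Complex.add_re, Complex.one_re] at htB htA
  rw [bell_fidelity_eq, Complex.re_ofReal_mul] at h
  simp only [Fin.sum_univ_two, Complex.add_re] at h hSA hSB
  have hB1 : (ptrB ρ 1 1).re = 1 - (ptrB ρ 0 0).re := by linarith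
  have hA1 : (ptrA ρ 1 1).re = 1 - (ptrA ρ 0 0).re := by linarith
  have k00 := key 0 0
  have k01 := key 0 1
  have k10 := key 1 0
  have k11 := key 1 1
  rw [hB1] at k10 k11
  rw [hA1] at k01 k11
  have hmul := mul_nonneg (sub_nonneg.mpr (mu_le_one hρ.1))
    (sub_nonneg.mpr (add_le_add hSA hSB))
  linarith
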